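/- arXiv:1103.4964 — 2 statements merged into one kernel-verified Lean document; each statement's English description precedes it below -/
import Mathlib

section
/- Assume in addition that dQ^n ⊆ Q^{n+1} and Q^n ∧ ε ⊆ Q^{n+2} for all n. Then for every s ≥ 1 and every j with j ≠ s, the differential d_{2s+1} : E_{2s+1}^{i,2j} → E_{2s+1}^{i+2s+1, 2j−2s} of the basic spectral sequence is zero. -/
/-!
Common algebraic model for the paper "Intersection cohomology of circle actions"
(Padilla–Saralegi), following the CONTEXT of the statements.

`A` models the (total space of the) graded-commutative differential graded ℝ-algebra
`A = ⊕ₙ Aⁿ` of liftable forms on the orbit space `B`; the grading is only recorded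
through the families of graded subspaces `P Q : ℤ → Submodule ℝ A` (the forms of
perverse degree `≤ p̄` resp. `≤ p̄ - x̄`), which vanish in negative degrees
(`Aⁿ = 0` for `n < 0`).  The differential is `d` with `d ∘ d = 0`, and
`e : A →ₗ[ℝ] A` is right multiplication by the fixed Euler form `ε ∈ A²`;
the hypotheses `dε = 0` together with the graded Leibniz rule amount exactly to
the commutation `d ∘ e = e ∘ d`, which is how we encode them.
-/

open Submodule LinearMap

noncomputable section

namespace IG

variable {A : Type*} [AddCommGroup A] [Module ℝ A]

/-- `Ω^n = {α ∈ P^n : dα ∈ P^(n+1)}`. -/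
def Om (d : A →ₗ[ℝ] A) (P : ℤ → Submodule ℝ A) (n : ℤ) : Submodule ℝ A :=
  P n ⊓ (P (n + 1)).comap d

/-- First component of `D` in degree `n` : `(α, β) ↦ dα + (-1)^(n-1) β∧ε`. -/
def D1 (d e : A →ₗ[ℝ] A) (n : ℤ) : A × A →ₗ[ℝ] A :=
  d ∘ₗ LinearMap.fst ℝ A A + ((-1 : ℝ) ^ (n - 1)) • (e ∘ₗ LinearMap.snd ℝ A A)

/-- `D(α,β) = (dα + (-1)^(n-1) β∧ε, dβ)` in degree `n`. -/
def Dmap (d e : A →ₗ[ℝ] A) (n : ℤ) : A × A →ₗ[ℝ] A × A :=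
  (D1 d e n).prod (d ∘ₗ LinearMap.snd ℝ A A)

/-- `K^n = {(α,β) ∈ P^n × Q^(n-1) : dβ ∈ Q^n, dα + (-1)^(n-1) β∧ε ∈ P^(n+1)}`. -/
def Ksub (d e : A →ₗ[ℝ] A) (P Q : ℤ → Submodule ℝ A) (n : ℤ) : Submodule ℝ (A × A) :=
  (P n).comap (LinearMap.fst ℝ A A) ⊓ (Q (n - 1)).comap (LinearMap.snd ℝ A A) ⊓
    (Q n).comap (d ∘ₗ LinearMap.snd ℝ A A) ⊓ (P (n + 1)).comap (D1 d e n)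

/-- `G^n = {β ∈ Q^n : dβ ∈ Q^(n+1), ∃ α ∈ P^(n+1), dα + (-1)^n β∧ε ∈ P^(n+2)}`. -/
def Gsub (d e : A →ₗ[ℝ] A) (P Q : ℤ → Submodule ℝ A) (n : ℤ) : Submodule ℝ A :=
  Q n ⊓ (Q (n + 1)).comap d ⊓
    (((P (n + 1)).comap (LinearMap.fst ℝ A A) ⊓
        (P (n + 2)).comap
          (d ∘ₗ LinearMap.fst ℝ A A + ((-1 : ℝ) ^ n) • (e ∘ₗ LinearMap.snd ℝ A A))).map
      (LinearMap.snd ℝ A A))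

/-- `C^m = ⊕_{i+2j=m} K^i ⊗ ℝ·u^j`, realized as the functions `ω : ℕ → A × A`
(`ω j` = the coefficient of `u^j`) with `ω j ∈ K^(m-2j)` for all `j`. -/
def Csub (d e : A →ₗ[ℝ] A) (P Q : ℤ → Submodule ℝ A) (m : ℤ) : Submodule ℝ (ℕ → A × A) :=
  ⨅ j : ℕ, (Ksub d e P Q (m - 2 * (j : ℤ))).comap (LinearMap.proj (R := ℝ) j)

/-- `∇((α,β) ⊗ u^j) = D(α,β) ⊗ u^j + (-1)^(n-1) (β,0) ⊗ u^(j+1)` on total degree `m`. -/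
def nabla (d e : A →ₗ[ℝ] A) (m : ℤ) : (ℕ → A × A) →ₗ[ℝ] (ℕ → A × A) :=
  LinearMap.pi fun j : ℕ =>
    Dmap d e (m - 2 * (j : ℤ)) ∘ₗ LinearMap.proj j +
      if j = 0 then 0
      else ((-1 : ℝ) ^ (m - 2 * ((j : ℤ) - 1) - 1)) •
        (LinearMap.inl ℝ A A ∘ₗ LinearMap.snd ℝ A A ∘ₗ LinearMap.proj (j - 1))

/-- Multiplication by `u` (degree 2) on an `ℝ[u]`-module realized as `ℕ → M`. -/
def shiftL (M : Type*) [AddCommGroup M] [Module ℝ M] : (ℕ → M) →ₗ[ℝ] (ℕ → M) :=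
  LinearMap.pi fun j : ℕ => if j = 0 then 0 else LinearMap.proj (j - 1)

/-- `π' (α ⊗ u^j) = (α, 0) ⊗ u^j`. -/
def piMap : (ℕ → A) →ₗ[ℝ] ℕ → A × A :=
  LinearMap.pi fun j : ℕ => LinearMap.inl ℝ A A ∘ₗ LinearMap.proj j

/-- `∮' ((α,β) ⊗ u^j) = β ⊗ u^j`. -/
def ointMap : (ℕ → A × A) →ₗ[ℝ] ℕ → A :=
  LinearMap.pi fun j : ℕ => LinearMap.snd ℝ A A ∘ₗ LinearMap.proj j

/-- `d ⊗ 1`. -/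
def dpi (d : A →ₗ[ℝ] A) : (ℕ → A) →ₗ[ℝ] ℕ → A :=
  LinearMap.pi fun j : ℕ => d ∘ₗ LinearMap.proj j

/-- `(Ω ⊗ ℝ[u])^m`. -/
def OmC (d : A →ₗ[ℝ] A) (P : ℤ → Submodule ℝ A) (m : ℤ) : Submodule ℝ (ℕ → A) :=
  ⨅ j : ℕ, (Om d P (m - 2 * (j : ℤ))).comap (LinearMap.proj (R := ℝ) j)

/-- `(G[-1] ⊗ ℝ[u])^m` (`G[-1]` places `G^n` in degree `n+1`). -/
def GCs (d e : A →ₗ[ℝ] A) (P Q : ℤ → Submodule ℝ A) (m : ℤ) : Submodule ℝ (ℕ → A) :=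
  ⨅ j : ℕ, (Gsub d e P Q (m - 1 - 2 * (j : ℤ))).comap (LinearMap.proj (R := ℝ) j)

/-- Cohomology presented as (cocycles) / (coboundaries). -/
abbrev Hq {M : Type*} [AddCommGroup M] [Module ℝ M] (Z B : Submodule ℝ M) :=
  Z ⧸ (B.comap Z.subtype)

/-- Cocycles of `Ω`. -/
def ZOm (d : A →ₗ[ℝ] A) (P : ℤ → Submodule ℝ A) (n : ℤ) : Submodule ℝ A :=
  Om d P n ⊓ LinearMap.ker d

/-- Coboundaries of `Ω`. -/
def BOm (d : A →ₗ[ℝ] A) (P : ℤ → Submodule ℝ A) (n : ℤ) : Submodule ℝ A :=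
  (Om d P (n - 1)).map d

/-- `H^n(Ω)`. -/
abbrev HOm (d : A →ₗ[ℝ] A) (P : ℤ → Submodule ℝ A) (n : ℤ) :=
  Hq (ZOm d P n) (BOm d P n)

/-- Cocycles of `G`. -/
def ZG (d e : A →ₗ[ℝ] A) (P Q : ℤ → Submodule ℝ A) (n : ℤ) : Submodule ℝ A :=
  Gsub d e P Q n ⊓ LinearMap.ker d

/-- Coboundaries of `G`. -/
def BG (d e : A →ₗ[ℝ] A) (P Q : ℤ → Submodule ℝ A) (n : ℤ) : Submodule ℝ A :=
  (Gsub d e P Q (n - 1)).map d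

/-- `H^n(G)`. -/
abbrev HG (d e : A →ₗ[ℝ] A) (P Q : ℤ → Submodule ℝ A) (n : ℤ) :=
  Hq (ZG d e P Q n) (BG d e P Q n)

/-- The co-Gysin space `𝒦^n = Ω^n / G^n` (cochain level). -/
abbrev Kq (d e : A →ₗ[ℝ] A) (P Q : ℤ → Submodule ℝ A) (n : ℤ) :=
  (Om d P n) ⧸ ((Gsub d e P Q n).comap (Om d P n).subtype)

/-- Cocycles of the co-Gysin complex `𝒦 = Ω/G`, presented by representatives:
`α ∈ Ω^n` with `dα ∈ G^(n+1)`. -/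
def ZKo (d e : A →ₗ[ℝ] A) (P Q : ℤ → Submodule ℝ A) (n : ℤ) : Submodule ℝ A :=
  Om d P n ⊓ (Gsub d e P Q (n + 1)).comap d

/-- Representatives of coboundaries of `𝒦 = Ω/G`. -/
def BKo (d e : A →ₗ[ℝ] A) (P Q : ℤ → Submodule ℝ A) (n : ℤ) : Submodule ℝ A :=
  Gsub d e P Q n ⊔ (Om d P (n - 1)).map d

/-- `H^n(𝒦)`. -/
abbrev HKo (d e : A →ₗ[ℝ] A) (P Q : ℤ → Submodule ℝ A) (n : ℤ) :=
  Hq (ZKo d e P Q n) (BKo d e P Q n)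

/-- Cocycles of `(C, ∇)`. -/
def ZC (d e : A →ₗ[ℝ] A) (P Q : ℤ → Submodule ℝ A) (m : ℤ) : Submodule ℝ (ℕ → A × A) :=
  Csub d e P Q m ⊓ LinearMap.ker (nabla d e m)

/-- Coboundaries of `(C, ∇)`. -/
def BC (d e : A →ₗ[ℝ] A) (P Q : ℤ → Submodule ℝ A) (m : ℤ) : Submodule ℝ (ℕ → A × A) :=
  (Csub d e P Q (m - 1)).map (nabla d e (m - 1))

/-- `H^m(C)`, the equivariant intersection cohomology. -/
abbrev HC (d e : A →ₗ[ℝ] A) (P Q : ℤ → Submodule ℝ A) (m : ℤ) :=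
  Hq (ZC d e P Q m) (BC d e P Q m)

/-- Cocycles of `(Ω ⊗ ℝ[u], d ⊗ 1)`. -/
def ZOmC (d : A →ₗ[ℝ] A) (P : ℤ → Submodule ℝ A) (m : ℤ) : Submodule ℝ (ℕ → A) :=
  OmC d P m ⊓ LinearMap.ker (dpi d)

/-- Coboundaries of `(Ω ⊗ ℝ[u], d ⊗ 1)`. -/
def BOmC (d : A →ₗ[ℝ] A) (P : ℤ → Submodule ℝ A) (m : ℤ) : Submodule ℝ (ℕ → A) :=
  (OmC d P (m - 1)).map (dpi d)

/-- `[H(Ω) ⊗ ℝ[u]]^m`, as the cohomology of the complex `(Ω ⊗ ℝ[u], d ⊗ 1)`. -/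
abbrev HOmCq (d : A →ₗ[ℝ] A) (P : ℤ → Submodule ℝ A) (m : ℤ) :=
  Hq (ZOmC d P m) (BOmC d P m)

/-- Cocycles of `(G[-1] ⊗ ℝ[u], d ⊗ 1)`. -/
def ZGC (d e : A →ₗ[ℝ] A) (P Q : ℤ → Submodule ℝ A) (m : ℤ) : Submodule ℝ (ℕ → A) :=
  GCs d e P Q m ⊓ LinearMap.ker (dpi d)

/-- Coboundaries of `(G[-1] ⊗ ℝ[u], d ⊗ 1)`. -/
def BGC (d e : A →ₗ[ℝ] A) (P Q : ℤ → Submodule ℝ A) (m : ℤ) : Submodule ℝ (ℕ → A) :=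
  (GCs d e P Q (m - 1)).map (dpi d)

/-- `[H(G) ⊗ ℝ[u]]^(m-1)`, as the cohomology of `(G[-1] ⊗ ℝ[u], d ⊗ 1)` in degree `m`. -/
abbrev HGCq (d e : A →ₗ[ℝ] A) (P Q : ℤ → Submodule ℝ A) (m : ℤ) :=
  Hq (ZGC d e P Q m) (BGC d e P Q m)

/-- The subspace of `ω : ℕ → A × A` supported in (filtration) degrees `≥ i`
(for total degree `m`): `ω j = 0` whenever `m - 2j < i`. -/
def Supp (i m : ℤ) : Submodule ℝ (ℕ → A × A) :=
  ⨅ (j : ℕ) (_ : m - 2 * (j : ℤ) < i),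
    LinearMap.ker (LinearMap.proj (R := ℝ) (φ := fun _ : ℕ => A × A) j)

/-- The filtration `F^i C^m = {ω ∈ ⊕_{i'≥i} K^{i'} ⊗ ℝ[u] of total degree m :
∇ω ∈ ⊕_{i'≥i} K^{i'} ⊗ ℝ[u]}`. -/
def FC (d e : A →ₗ[ℝ] A) (P Q : ℤ → Submodule ℝ A) (i m : ℤ) : Submodule ℝ (ℕ → A × A) :=
  Csub d e P Q m ⊓ Supp i m ⊓ (Supp i (m + 1)).comap (nabla d e m)

/-- `Z_r^{i,j} = F^i C^(i+j) ∩ ∇⁻¹(F^(i+r) C^(i+j+1))`. -/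
def Zsp (d e : A →ₗ[ℝ] A) (P Q : ℤ → Submodule ℝ A) (r i j : ℤ) : Submodule ℝ (ℕ → A × A) :=
  FC d e P Q i (i + j) ⊓ (FC d e P Q (i + r) (i + j + 1)).comap (nabla d e (i + j))

/-- `B_r^{i,j} = F^i C^(i+j) ∩ ∇(F^(i-r) C^(i+j-1))`. -/
def Bsp (d e : A →ₗ[ℝ] A) (P Q : ℤ → Submodule ℝ A) (r i j : ℤ) : Submodule ℝ (ℕ → A × A) :=
  FC d e P Q i (i + j) ⊓ (FC d e P Q (i - r) (i + j - 1)).map (nabla d e (i + j - 1))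

/-- `E_r^{i,j} = Z_r^{i,j} / (Z_(r-1)^{i+1,j-1} + B_(r-1)^{i,j})`. -/
abbrev Esp (d e : A →ₗ[ℝ] A) (P Q : ℤ → Submodule ℝ A) (r i j : ℤ) :=
  Zsp d e P Q r i j ⧸
    ((Zsp d e P Q (r - 1) (i + 1) (j - 1) ⊔ Bsp d e P Q (r - 1) i j).comap
      (Zsp d e P Q r i j).subtype)

/-- The differential `d_r : E_r^{i,j} → E_r^{i+r,j-r+1}` is the map induced by `∇`
(the target indices `(i', j')` are given freely, to be instantiated by
expressions equal to `(i + r, j - r + 1)`). -/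
def DrChar (d e : A →ₗ[ℝ] A) (P Q : ℤ → Submodule ℝ A) (r i j i' j' : ℤ)
    (dr : Esp d e P Q r i j →ₗ[ℝ] Esp d e P Q r i' j') : Prop :=
  ∀ (ω : ℕ → A × A) (hω : ω ∈ Zsp d e P Q r i j)
    (hω' : nabla d e (i + j) ω ∈ Zsp d e P Q r i' j'),
    dr (Submodule.Quotient.mk ⟨ω, hω⟩) = Submodule.Quotient.mk ⟨nabla d e (i + j) ω, hω'⟩

/-- `α ↦ (α, 0) ⊗ u^0 = (α,0) ⊗ 1`. -/
def embL : A →ₗ[ℝ] ℕ → A × A :=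
  LinearMap.single ℝ (fun _ : ℕ => A × A) 0 ∘ₗ LinearMap.inl ℝ A A

/-- `ι̃ : H^n(G) → H^{n'}(Ω)` induced by the inclusion `G ⊆ Ω` (`n' = n`). -/
def iotaChar (d e : A →ₗ[ℝ] A) (P Q : ℤ → Submodule ℝ A) (n n' : ℤ)
    (ι : HG d e P Q n →ₗ[ℝ] HOm d P n') : Prop :=
  ∀ (β : A) (hβ : β ∈ ZG d e P Q n) (hβ' : β ∈ ZOm d P n'),
    ι (Submodule.Quotient.mk ⟨β, hβ⟩) = Submodule.Quotient.mk ⟨β, hβ'⟩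

/-- `𝕖 : H^n(G) → H^{n'}(Ω)`, `𝕖[β] = [dα + (-1)^n β∧ε]` for any witness `α`
(`n' = n + 2`). -/
def eulerChar (d e : A →ₗ[ℝ] A) (P Q : ℤ → Submodule ℝ A) (n n' : ℤ)
    (E : HG d e P Q n →ₗ[ℝ] HOm d P n') : Prop :=
  ∀ (β : A) (hβ : β ∈ ZG d e P Q n) (α : A) (_ : α ∈ P (n + 1))
    (hz : d α + ((-1 : ℝ) ^ n) • e β ∈ ZOm d P n'),
    E (Submodule.Quotient.mk ⟨β, hβ⟩) =
      Submodule.Quotient.mk ⟨d α + ((-1 : ℝ) ^ n) • e β, hz⟩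

/-- `∂ : H^n(𝒦) → H^{n'}(G)`, `∂[ᾱ] = [dα]` (`n' = n + 1`). -/
def partialChar (d e : A →ₗ[ℝ] A) (P Q : ℤ → Submodule ℝ A) (n n' : ℤ)
    (pd : HKo d e P Q n →ₗ[ℝ] HG d e P Q n') : Prop :=
  ∀ (α : A) (hα : α ∈ ZKo d e P Q n) (hd : d α ∈ ZG d e P Q n'),
    pd (Submodule.Quotient.mk ⟨α, hα⟩) = Submodule.Quotient.mk ⟨d α, hd⟩

/-- `Pr : H^n(Ω) → H^{n'}(𝒦)` induced by the projection `Ω → 𝒦 = Ω/G` (`n' = n`). -/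
def prChar (d e : A →ₗ[ℝ] A) (P Q : ℤ → Submodule ℝ A) (n n' : ℤ)
    (pr : HOm d P n →ₗ[ℝ] HKo d e P Q n') : Prop :=
  ∀ (α : A) (hα : α ∈ ZOm d P n) (hα' : α ∈ ZKo d e P Q n'),
    pr (Submodule.Quotient.mk ⟨α, hα⟩) = Submodule.Quotient.mk ⟨α, hα'⟩

/-- The sign `(-1)^(m-1)` only depends on the parity of the degree. -/
theorem sign_sub_two_mul (m l : ℤ) : (-1 : ℝ) ^ (m - 2 * l - 1) = (-1) ^ (m - 1) := by
  rw [show m - 2 * l - 1 = (m - 1) + 2 * (-l) by ring, zpow_add₀ (by norm_num), zpow_mul]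
  norm_num

theorem sign_succ (m : ℤ) : (-1 : ℝ) ^ (m + 1 - 1) = -(-1) ^ (m - 1) := by
  rw [show m + 1 - 1 = (m - 1) + 1 by ring, zpow_add₀ (by norm_num)]
  norm_num

theorem nabla_apply (d e : A →ₗ[ℝ] A) (m : ℤ) (ω : ℕ → A × A) (l : ℕ) :
    nabla d e m ω l =
      (d (ω l).1 + ((-1 : ℝ) ^ (m - 1)) • e (ω l).2 +
        ((-1 : ℝ) ^ (m - 1)) • (if l = 0 then 0 else (ω (l - 1)).2), d (ω l).2) := by
  have h := sign_sub_two_mul m l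
  have h' := sign_sub_two_mul m ((l : ℤ) - 1)
  ext <;> by_cases hl : l = 0 <;> simp [nabla, Dmap, D1, hl, h, h'] at *

theorem nabla_nabla {d e : A →ₗ[ℝ] A} (hd : d ∘ₗ d = 0) (hde : d ∘ₗ e = e ∘ₗ d) (m : ℤ)
    (ω : ℕ → A × A) : nabla d e (m + 1) (nabla d e m ω) = 0 := by
  have hd' : ∀ x, d (d x) = 0 := fun x => LinearMap.congr_fun hd x
  have hde' : ∀ x, d (e x) = e (d x) := fun x => LinearMap.congr_fun hde x
  funext l
  rw [nabla_apply, sign_succ]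
  by_cases hl : l = 0 <;> ext <;> simp [nabla_apply, hd', hde', hl]

section Csub

variable {d e : A →ₗ[ℝ] A} {P Q : ℤ → Submodule ℝ A}

theorem mem_Csub_iff (hQP : ∀ n, Q n ≤ P n) (hdQ : ∀ n : ℤ, (Q n).map d ≤ Q (n + 1))
    (heQ : ∀ n : ℤ, (Q n).map e ≤ Q (n + 2)) {m : ℤ} {ω : ℕ → A × A} :
    ω ∈ Csub d e P Q m ↔ ∀ l : ℕ, (ω l).1 ∈ P (m - 2 * l) ∧
      d (ω l).1 ∈ P (m - 2 * l + 1) ∧ (ω l).2 ∈ Q (m - 2 * l - 1) := by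
  simp only [Csub, Ksub, D1, Submodule.mem_iInf, Submodule.mem_comap, Submodule.mem_inf,
    LinearMap.proj_apply, LinearMap.fst_apply, LinearMap.snd_apply, LinearMap.comp_apply,
    LinearMap.add_apply, LinearMap.smul_apply]
  refine forall_congr' fun l => ?_
  have key : (ω l).2 ∈ Q (m - 2 * l - 1) →
      ((-1 : ℝ) ^ (m - 2 * (l : ℤ) - 1)) • e (ω l).2 ∈ P (m - 2 * l + 1) := fun h => by
    have h2 := hQP _ (heQ _ (Submodule.mem_map_of_mem h))
    rw [show m - 2 * (l : ℤ) - 1 + 2 = m - 2 * l + 1 by ring] at h2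
    exact Submodule.smul_mem _ _ h2
  constructor
  · rintro ⟨⟨⟨h1, h2⟩, -⟩, h4⟩
    exact ⟨h1, (Submodule.add_mem_iff_left _ (key h2)).1 h4, h2⟩
  · rintro ⟨h1, h2, h3⟩
    have h4 := hdQ _ (Submodule.mem_map_of_mem h3)
    rw [sub_add_cancel] at h4
    exact ⟨⟨⟨h1, h3⟩, h4⟩, Submodule.add_mem _ h2 (key h3)⟩

theorem nabla_mem_Csub (hd : d ∘ₗ d = 0) (hQP : ∀ n, Q n ≤ P n)
    (hdQ : ∀ n : ℤ, (Q n).map d ≤ Q (n + 1)) (heQ : ∀ n : ℤ, (Q n).map e ≤ Q (n + 2))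
    {m : ℤ} {ω : ℕ → A × A} (hω : ω ∈ Csub d e P Q m) :
    nabla d e m ω ∈ Csub d e P Q (m + 1) := by
  have hd' : ∀ x, d (d x) = 0 := fun x => LinearMap.congr_fun hd x
  rw [mem_Csub_iff hQP hdQ heQ] at hω ⊢
  intro l
  obtain ⟨-, h2, h3⟩ := hω l
  have he : e (ω l).2 ∈ Q (m + 1 - 2 * l) := by
    have := heQ _ (Submodule.mem_map_of_mem h3)
    rwa [show m - 2 * (l : ℤ) - 1 + 2 = m + 1 - 2 * l by ring] at this
  have hβ : (if l = 0 then 0 else (ω (l - 1)).2) ∈ Q (m + 1 - 2 * l) := by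
    rcases l with _ | l
    · simp
    · have := (hω l).2.2
      rw [show m - 2 * (l : ℤ) - 1 = m + 1 - 2 * ((l + 1 : ℕ) : ℤ) by push_cast; ring] at this
      simpa using this
  have hq := Submodule.add_mem _ (Submodule.smul_mem _ ((-1 : ℝ) ^ (m - 1)) he)
    (Submodule.smul_mem _ ((-1 : ℝ) ^ (m - 1)) hβ)
  rw [nabla_apply]
  refine ⟨?_, ?_, ?_⟩
  · rw [add_assoc]
    refine Submodule.add_mem _ ?_ (hQP _ hq)
    rwa [show m + 1 - 2 * (l : ℤ) = m - 2 * l + 1 by ring]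
  · rw [add_assoc, map_add, hd', zero_add]
    exact hQP _ (hdQ _ (Submodule.mem_map_of_mem hq))
  · have := hdQ _ (Submodule.mem_map_of_mem h3)
    rwa [show m - 2 * (l : ℤ) - 1 + 1 = m + 1 - 2 * l - 1 by ring] at this

end Csub

theorem mem_Supp_iff {i m : ℤ} {ω : ℕ → A × A} :
    ω ∈ Supp i m ↔ ∀ l : ℕ, m - 2 * (l : ℤ) < i → ω l = 0 := by
  simp [Supp, Submodule.mem_iInf]

theorem mem_FC_of_nabla_eq_zero {d e : A →ₗ[ℝ] A} {P Q : ℤ → Submodule ℝ A} {i m : ℤ}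
    {ω : ℕ → A × A} (hC : ω ∈ Csub d e P Q m) (hS : ω ∈ Supp i m) (h : nabla d e m ω = 0) :
    ω ∈ FC d e P Q i m :=
  ⟨⟨hC, hS⟩, by simp [h]⟩

/-- The part of `ω` responsible for the coefficient of `u^(k+1)` in `∇ω`:
`(α_{k+1}, 0) ⊗ u^(k+1) + (0, β_k + β_{k+1}∧ε) ⊗ u^k`. -/
def correction (e : A →ₗ[ℝ] A) (ω : ℕ → A × A) (k : ℕ) : ℕ → A × A := fun l =>
  if l = k + 1 then ((ω (k + 1)).1, 0)
  else if l = k then (0, (ω k).2 + e (ω (k + 1)).2) else 0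

theorem correction_mem_Csub {d e : A →ₗ[ℝ] A} {P Q : ℤ → Submodule ℝ A}
    (hQP : ∀ n, Q n ≤ P n) (hdQ : ∀ n : ℤ, (Q n).map d ≤ Q (n + 1))
    (heQ : ∀ n : ℤ, (Q n).map e ≤ Q (n + 2)) {m : ℤ} {ω : ℕ → A × A}
    (hω : ω ∈ Csub d e P Q m) (k : ℕ) : correction e ω k ∈ Csub d e P Q m := by
  rw [mem_Csub_iff hQP hdQ heQ] at hω ⊢
  intro l
  unfold correction
  split_ifs with h1 h2
  · subst h1
    exact ⟨(hω _).1, (hω _).2.1, Submodule.zero_mem _⟩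
  · subst h2
    have := heQ _ (Submodule.mem_map_of_mem (hω (l + 1)).2.2)
    rw [show m - 2 * ((l + 1 : ℕ) : ℤ) - 1 + 2 = m - 2 * l - 1 by push_cast; ring] at this
    exact ⟨Submodule.zero_mem _, by simp, Submodule.add_mem _ (hω l).2.2 this⟩
  · simp

theorem nabla_correction_of_lt (d e : A →ₗ[ℝ] A) (m : ℤ) (ω : ℕ → A × A) {k l : ℕ}
    (h : k + 1 < l) : nabla d e m (correction e ω k) l = 0 := by
  have h1 : l ≠ k + 1 := by omega
  have h2 : l ≠ k := by omega
  have h3 : l - 1 ≠ k := by omega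
  rw [nabla_apply]
  by_cases h4 : l - 1 = k + 1 <;> simp [correction, h1, h2, h3, h4]

theorem nabla_correction_succ (d e : A →ₗ[ℝ] A) (m : ℤ) (ω : ℕ → A × A) (k : ℕ)
    (h : (nabla d e m ω (k + 1)).2 = 0) :
    nabla d e m (correction e ω k) (k + 1) = nabla d e m ω (k + 1) := by
  rw [nabla_apply] at h
  rw [nabla_apply, nabla_apply]
  ext
  · simp [correction]
    abel
  · simpa [correction] using h.symm

/-- assume moreover `dQ^n ⊆ Q^(n+1)` and `Q^n ∧ ε ⊆ Q^(n+2)` for all `n`.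
Then for every `s ≥ 1` and every `j ≠ s`, the differential
`d_{2s+1} : E_{2s+1}^{i,2j} → E_{2s+1}^{i+2s+1,2j-2s}` of the basic spectral
sequence is zero. -/
theorem statement_12 {A : Type*} [AddCommGroup A] [Module ℝ A]
    (d e : A →ₗ[ℝ] A) (hd : d ∘ₗ d = 0) (hde : d ∘ₗ e = e ∘ₗ d)
    (P Q : ℤ → Submodule ℝ A) (hQP : ∀ n, Q n ≤ P n)
    (hPneg : ∀ n : ℤ, n < 0 → P n = ⊥) (hQneg : ∀ n : ℤ, n < 0 → Q n = ⊥)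
    (hdQ : ∀ n : ℤ, (Q n).map d ≤ Q (n + 1))
    (heQ : ∀ n : ℤ, (Q n).map e ≤ Q (n + 2)) :
    ∀ s : ℤ, 1 ≤ s → ∀ i j : ℤ, j ≠ s →
      ∀ dr : Esp d e P Q (2 * s + 1) i (2 * j) →ₗ[ℝ]
          Esp d e P Q (2 * s + 1) (i + 2 * s + 1) (2 * j - 2 * s),
        DrChar d e P Q (2 * s + 1) i (2 * j) (i + 2 * s + 1) (2 * j - 2 * s) dr →
          dr = 0 := by
  intro s hs i j hj dr hdr
  refine LinearMap.ext fun x => ?_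
  obtain ⟨⟨ω, hω⟩, rfl⟩ := Submodule.Quotient.mk_surjective _ x
  obtain ⟨⟨⟨hC, -⟩, -⟩, ⟨-, hT⟩, -⟩ := id hω
  have hdeg : i + 2 * s + 1 + (2 * j - 2 * s) = i + 2 * j + 1 := by ring
  have hηC := nabla_mem_Csub hd hQP hdQ heQ hC
  have hηz := nabla_nabla hd hde (i + 2 * j) ω
  have hω' : nabla d e (i + 2 * j) ω ∈
      Zsp d e P Q (2 * s + 1) (i + 2 * s + 1) (2 * j - 2 * s) := by
    rw [Zsp, hdeg, Submodule.mem_inf, Submodule.mem_comap, hηz]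
    refine ⟨mem_FC_of_nabla_eq_zero hηC ?_ hηz, Submodule.zero_mem _⟩
    rwa [show i + 2 * s + 1 = i + (2 * s + 1) by ring]
  rw [hdr ω hω hω', LinearMap.zero_apply, Submodule.Quotient.mk_eq_zero, Submodule.mem_comap]
  change nabla d e (i + 2 * j) ω ∈ _
  have hT₀ := mem_Supp_iff.1 hT
  rcases lt_or_gt_of_ne hj with hlt | hgt
  · have h0 : nabla d e (i + 2 * j) ω = 0 := funext fun l => hT₀ l (by omega)
    rw [h0]
    exact Submodule.zero_mem _
  obtain ⟨k, hk⟩ : ∃ k : ℕ, j - s = k + 1 := ⟨(j - s - 1).toNat, by omega⟩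
  have hξC := correction_mem_Csub hQP hdQ heQ hC k
  have hξzC := nabla_mem_Csub hd hQP hdQ heQ hξC
  have hξz := nabla_nabla hd hde (i + 2 * j) (correction e ω k)
  -- `∇∇ω = 0` kills the second component of the top coefficient of `∇ω`
  have htop : (nabla d e (i + 2 * j) ω (k + 1)).2 = 0 := by
    have h := congrFun hηz (k + 2)
    rw [nabla_apply] at h
    have h1 := hT₀ (k + 2) (by push_cast; omega)
    simpa [h1, zpow_ne_zero] using congrArg Prod.fst h
  rw [← sub_add_cancel (nabla d e (i + 2 * j) ω) (nabla d e (i + 2 * j) (correction e ω k))]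
  refine Submodule.add_mem_sup ?_ ?_
  · have hz : nabla d e (i + 2 * j + 1) (nabla d e (i + 2 * j) ω -
        nabla d e (i + 2 * j) (correction e ω k)) = 0 := by rw [map_sub, hηz, hξz, sub_zero]
    rw [Zsp, show i + 2 * s + 1 + 1 + (2 * j - 2 * s - 1) = i + 2 * j + 1 by ring,
      Submodule.mem_inf, Submodule.mem_comap, hz]
    refine ⟨mem_FC_of_nabla_eq_zero (Submodule.sub_mem _ hηC hξzC) ?_ hz,
      Submodule.zero_mem _⟩
    rw [mem_Supp_iff]
    intro l hl
    rw [Pi.sub_apply]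
    rcases eq_or_ne l (k + 1) with rfl | hne
    · rw [nabla_correction_succ d e _ ω k htop, sub_self]
    · rw [hT₀ l (by omega), nabla_correction_of_lt d e _ ω (by omega), sub_zero]
  · rw [Bsp, hdeg, add_sub_cancel_right]
    refine ⟨mem_FC_of_nabla_eq_zero hξzC (mem_Supp_iff.2 fun l hl =>
      nabla_correction_of_lt d e _ ω (by omega)) hξz,
      Submodule.mem_map_of_mem ⟨⟨hξC, mem_Supp_iff.2 fun l hl => ?_⟩,
        mem_Supp_iff.2 fun l hl => nabla_correction_of_lt d e _ ω (by omega)⟩⟩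
    have h1 : l ≠ k + 1 := by omega
    have h2 : l ≠ k := by omega
    simp [correction, h1, h2]

end IG

end
end

section
/- Let ε' ∈ A^2 with dε' = 0, and suppose ε − ε' = dγ for some γ ∈ A^1 satisfying Q^n ∧ γ ⊆ P^{n+1} for all n. Denote by K_ε and K_{ε'} the complexes built from ε and ε' respectively, and by C_ε, C_{ε'} the corresponding equivariant complexes. Then Φ(α,β) = (α + β∧γ, β) defines an isomorphism of cochain complexes Φ : (K_ε, D_ε) → (K_{ε'}, D_{ε'}) which restricts to the identity on the subcomplex {(α,0) : α ∈ Ω} and satisfies ∮' ∘ Φ = ∮' (i.e., Φ preserves second components); moreover Φ ⊗ id_{ℝ[u]} : (C_ε, ∇_ε) → (C_{ε'}, ∇_{ε'}) is an isomorphism of complexes of ℝ[u]-modules commuting with the maps π', and the subcomplex G computed from ε equals the subcomplex G computed from ε'. -/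
/-!
Common algebraic model for the paper "Intersection cohomology of circle actions"
(Padilla–Saralegi), following the CONTEXT of the statements.

`A` models the (total space of the) graded-commutative differential graded ℝ-algebra
`A = ⊕ₙ Aⁿ` of liftable forms on the orbit space `B`; the grading is only recorded
through the families of graded subspaces `P Q : ℤ → Submodule ℝ A` (the forms of
perverse degree `≤ p̄` resp. `≤ p̄ - x̄`), which vanish in negative degrees
(`Aⁿ = 0` for `n < 0`).  The differential is `d` with `d ∘ d = 0`, and
`e : A →ₗ[ℝ] A` is right multiplication by the fixed Euler form `ε ∈ A²`;
the hypotheses `dε = 0` together with the graded Leibniz rule amount exactly to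
the commutation `d ∘ e = e ∘ d`, which is how we encode them.
-/

open Submodule LinearMap

noncomputable section

namespace IG

variable {A : Type*} [AddCommGroup A] [Module ℝ A]

/-- The shear `(α, β) ↦ (α + g β, β)`. -/
def shear (g : A →ₗ[ℝ] A) : A × A →ₗ[ℝ] A × A :=
  (LinearMap.fst ℝ A A + g ∘ₗ LinearMap.snd ℝ A A).prod (LinearMap.snd ℝ A A)

@[simp]
theorem shear_apply (g : A →ₗ[ℝ] A) (x : A × A) : shear g x = (x.1 + g x.2, x.2) := rfl

@[simp]
theorem D1_apply (d e : A →ₗ[ℝ] A) (n : ℤ) (x : A × A) :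
    D1 d e n x = d x.1 + ((-1 : ℝ) ^ (n - 1)) • e x.2 := rfl

@[simp]
theorem Dmap_apply (d e : A →ₗ[ℝ] A) (n : ℤ) (x : A × A) :
    Dmap d e n x = (D1 d e n x, d x.2) := rfl

theorem mem_Ksub {d e : A →ₗ[ℝ] A} {P Q : ℤ → Submodule ℝ A} {n : ℤ} {x : A × A} :
    x ∈ Ksub d e P Q n ↔
      x.1 ∈ P n ∧ x.2 ∈ Q (n - 1) ∧ d x.2 ∈ Q n ∧ D1 d e n x ∈ P (n + 1) := by
  simp [Ksub, and_assoc]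

theorem mem_Gsub {d e : A →ₗ[ℝ] A} {P Q : ℤ → Submodule ℝ A} {n : ℤ} {β : A} :
    β ∈ Gsub d e P Q n ↔ β ∈ Q n ∧ d β ∈ Q (n + 1) ∧
      ∃ α ∈ P (n + 1), d α + ((-1 : ℝ) ^ n) • e β ∈ P (n + 2) := by
  simp [Gsub, and_assoc]

theorem mem_Csub {d e : A →ₗ[ℝ] A} {P Q : ℤ → Submodule ℝ A} {m : ℤ} {ω : ℕ → A × A} :
    ω ∈ Csub d e P Q m ↔ ∀ j : ℕ, ω j ∈ Ksub d e P Q (m - 2 * (j : ℤ)) := by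
  simp [Csub]

/-- `e` and `e'` differ on each `Q n` by the graded commutator of `d` and `g`: the operator form
of `ε - ε' = dγ`. -/
def IsHomotopyOn (d e e' g : A →ₗ[ℝ] A) (Q : ℤ → Submodule ℝ A) : Prop :=
  ∀ (n : ℤ) (x : A), x ∈ Q n → e x - e' x = ((-1 : ℝ) ^ n) • (d (g x) - g (d x))

section Homotopy

variable {d e e' g : A →ₗ[ℝ] A} {P Q : ℤ → Submodule ℝ A}

theorem IsHomotopyOn.symm (h : IsHomotopyOn d e e' g Q) : IsHomotopyOn d e' e (-g) Q := by
  intro n x hx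
  rw [← neg_sub, h n x hx, ← smul_neg]
  simp only [LinearMap.neg_apply, map_neg]
  congr 1
  abel

theorem IsHomotopyOn.d_add (h : IsHomotopyOn d e e' g Q) {n : ℤ} {β : A} (hβ : β ∈ Q n) (α : A) :
    d (α + g β) + ((-1 : ℝ) ^ n) • e' β = d α + ((-1 : ℝ) ^ n) • e β + g (d β) := by
  have hsq : ((-1 : ℝ) ^ n) * (-1 : ℝ) ^ n = 1 := by
    rw [← mul_zpow]
    simp
  have key : ((-1 : ℝ) ^ n) • e β - ((-1 : ℝ) ^ n) • e' β = d (g β) - g (d β) := by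
    rw [← smul_sub, h n β hβ, smul_smul, hsq, one_smul]
  rw [map_add, ← sub_eq_zero]
  rw [← sub_eq_zero] at key
  rw [← neg_eq_zero, ← key]
  abel

theorem neg_mapsTo (hgQ : ∀ n : ℤ, ∀ x ∈ Q n, g x ∈ P (n + 1)) :
    ∀ n : ℤ, ∀ x ∈ Q n, (-g) x ∈ P (n + 1) :=
  fun n x hx => (P (n + 1)).neg_mem (hgQ n x hx)

theorem shear_mem_Ksub (h : IsHomotopyOn d e e' g Q)
    (hgQ : ∀ n : ℤ, ∀ x ∈ Q n, g x ∈ P (n + 1)) {n : ℤ} {x : A × A}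
    (hx : x ∈ Ksub d e P Q n) : shear g x ∈ Ksub d e' P Q n := by
  obtain ⟨hα, hβ, hdβ, hD⟩ := mem_Ksub.1 hx
  refine mem_Ksub.2 ⟨(P n).add_mem hα ?_, hβ, hdβ, ?_⟩
  · simpa using hgQ _ _ hβ
  · rw [D1_apply, shear_apply, h.d_add hβ]
    exact (P (n + 1)).add_mem hD (hgQ n _ hdβ)

theorem Dmap_shear (h : IsHomotopyOn d e e' g Q) {n : ℤ} {x : A × A}
    (hx : x ∈ Ksub d e P Q n) : Dmap d e' n (shear g x) = shear g (Dmap d e n x) := by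
  simp only [Dmap_apply, D1_apply, shear_apply, h.d_add (mem_Ksub.1 hx).2.1]

theorem Gsub_le (h : IsHomotopyOn d e e' g Q) (hgQ : ∀ n : ℤ, ∀ x ∈ Q n, g x ∈ P (n + 1))
    (n : ℤ) : Gsub d e P Q n ≤ Gsub d e' P Q n := by
  intro β hβ
  obtain ⟨hβ, hdβ, α, hα, hD⟩ := mem_Gsub.1 hβ
  refine mem_Gsub.2 ⟨hβ, hdβ, α + g β, (P (n + 1)).add_mem hα (hgQ n β hβ), ?_⟩
  rw [h.d_add hβ]
  refine (P (n + 2)).add_mem hD ?_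
  simpa [add_assoc] using hgQ _ _ hdβ

end Homotopy

theorem shear_shear_neg (g : A →ₗ[ℝ] A) (x : A × A) : shear g (shear (-g) x) = x := by
  simp

theorem shear_injective (g : A →ₗ[ℝ] A) : Function.Injective (shear g) :=
  Function.LeftInverse.injective (g := shear (-g)) fun x => by simp

/-- let `ε' ∈ A²` be closed with `ε - ε' = dγ`, `γ ∈ A¹`, such that
`Q^n ∧ γ ⊆ P^(n+1)`.  Here `e' = (·∧ε')` and `g = (·∧γ)`; closedness of `ε'` is
encoded by `d ∘ e' = e' ∘ d`, and `ε - ε' = dγ` by the graded Leibniz rule: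
`x∧ε - x∧ε' = (-1)^n (d(x∧γ) - (dx)∧γ)` for `x` of degree `n` (we require it for
`x ∈ Q^n`, the only elements to which `γ` is ever applied).  Then
`Φ(α,β) = (α + β∧γ, β)` is an isomorphism of cochain complexes
`(K_ε, D_ε) ≅ (K_ε', D_ε')` restricting to the identity on `{(α,0) : α ∈ Ω}` and
preserving second components; `Φ ⊗ id` is an isomorphism `(C_ε, ∇_ε) ≅ (C_ε', ∇_ε')`
of complexes of `ℝ[u]`-modules commuting with `π'`; and `G_ε = G_ε'`. -/
theorem statement_15 {A : Type*} [AddCommGroup A] [Module ℝ A]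
    (d e e' g : A →ₗ[ℝ] A) (hd : d ∘ₗ d = 0)
    (hde : d ∘ₗ e = e ∘ₗ d) (hde' : d ∘ₗ e' = e' ∘ₗ d)
    (P Q : ℤ → Submodule ℝ A) (hQP : ∀ n, Q n ≤ P n)
    (hPneg : ∀ n : ℤ, n < 0 → P n = ⊥) (hQneg : ∀ n : ℤ, n < 0 → Q n = ⊥)
    (hgQ : ∀ n : ℤ, (Q n).map g ≤ P (n + 1))
    (hγ : ∀ (n : ℤ) (x : A), x ∈ Q n →
      e x - e' x = ((-1 : ℝ) ^ n) • (d (g x) - g (d x))) :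
    -- Φ = (α,β) ↦ (α + β∧γ, β)
    ∀ Φ : A × A →ₗ[ℝ] A × A,
      Φ = (LinearMap.fst ℝ A A + g ∘ₗ LinearMap.snd ℝ A A).prod (LinearMap.snd ℝ A A) →
      -- Φ : K_ε^n ≅ K_ε'^n, an isomorphism of cochain complexes
      Function.Injective Φ ∧
      (∀ n : ℤ, (Ksub d e P Q n).map Φ = Ksub d e' P Q n) ∧
      (∀ (n : ℤ) (x : A × A), x ∈ Ksub d e P Q n →
        Dmap d e' n (Φ x) = Φ (Dmap d e n x)) ∧
      -- Φ restricts to the identity on the subcomplex {(α, 0)}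
      (∀ α : A, Φ (α, 0) = (α, 0)) ∧
      -- Φ preserves second components, i.e. ∮' ∘ Φ = ∮'
      (∀ x : A × A, (Φ x).2 = x.2) ∧
      -- Φ ⊗ id : (C_ε, ∇_ε) ≅ (C_ε', ∇_ε'), an isomorphism of complexes of ℝ[u]-modules
      (∀ ΦC : (ℕ → A × A) →ₗ[ℝ] ℕ → A × A,
        ΦC = LinearMap.pi (fun j : ℕ => Φ ∘ₗ LinearMap.proj j) →
        Function.Injective ΦC ∧
        (∀ m : ℤ, (Csub d e P Q m).map ΦC = Csub d e' P Q m) ∧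
        (∀ (m : ℤ) (ω : ℕ → A × A), ω ∈ Csub d e P Q m →
          nabla d e' m (ΦC ω) = ΦC (nabla d e m ω)) ∧
        -- ℝ[u]-linearity
        (∀ ω : ℕ → A × A, ΦC (shiftL (A × A) ω) = shiftL (A × A) (ΦC ω)) ∧
        -- commutation with π'
        (∀ ω : ℕ → A, ΦC (piMap ω) = piMap ω)) ∧
      -- the Gysin subcomplex is unchanged
      (∀ n : ℤ, Gsub d e P Q n = Gsub d e' P Q n) := by
  rintro Φ rfl
  have h : IsHomotopyOn d e e' g Q := hγ
  have hg : ∀ n : ℤ, ∀ x ∈ Q n, g x ∈ P (n + 1) := fun n x hx =>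
    hgQ n (Submodule.mem_map_of_mem hx)
  change Function.Injective (shear g) ∧ _
  refine ⟨shear_injective g, fun n => le_antisymm ?_ ?_, fun n x hx => Dmap_shear h hx,
    fun α => by simp, fun x => rfl, ?_,
    fun n => le_antisymm (Gsub_le h hg n) (Gsub_le h.symm (neg_mapsTo hg) n)⟩
  · rintro _ ⟨x, hx, rfl⟩
    exact shear_mem_Ksub h hg hx
  · exact fun x hx => ⟨shear (-g) x, shear_mem_Ksub h.symm (neg_mapsTo hg) hx,
      shear_shear_neg g x⟩
  rintro ΦC rfl
  change Function.Injective (LinearMap.pi fun j : ℕ => shear g ∘ₗ LinearMap.proj j) ∧ _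
  refine ⟨fun ω ω' hω => funext fun j => shear_injective g (congrFun hω j),
    fun m => le_antisymm ?_ ?_, fun m ω hω => funext fun j => ?_, fun ω => funext fun j => ?_,
    fun ω => funext fun j => ?_⟩
  · rintro _ ⟨ω, hω, rfl⟩
    exact mem_Csub.2 fun j => shear_mem_Ksub h hg (mem_Csub.1 hω j)
  · exact fun ω hω => ⟨fun j => shear (-g) (ω j),
      mem_Csub.2 fun j => shear_mem_Ksub h.symm (neg_mapsTo hg) (mem_Csub.1 hω j),
      funext fun j => shear_shear_neg g (ω j)⟩
  · have hD : Dmap d e' (m - 2 * (j : ℤ)) (shear g (ω j)) =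
        shear g (Dmap d e (m - 2 * (j : ℤ)) (ω j)) := Dmap_shear h (mem_Csub.1 hω j)
    change (_ : A × A) = shear g (nabla d e m ω j)
    simp only [nabla, LinearMap.pi_apply, LinearMap.add_apply, LinearMap.comp_apply,
      LinearMap.proj_apply, map_add]
    refine congrArg₂ (· + ·) hD ?_
    split_ifs
    · exact (map_zero (shear g)).symm
    · simp
  · change shear g (shiftL (A × A) ω j) = _
    simp only [shiftL, LinearMap.pi_apply]
    split_ifs
    · simp
    · rfl
  · change shear g (ω j, 0) = (ω j, 0)
    simp

end IG

end
end
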